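/- Let (Ω, X_n, ℙ_x) be a Markov chain on a nonempty finite set V, let A ⊆ V with ℙ_z(τ_A < ∞) = 1 for every z ∈ V, let b ∈ V ∖ A and write A^c = V ∖ A. Define the random finite path L^{(1)} from X|_{[0,τ_A]} as follows: if b does not occur in 𝔏(X|_{[0,τ_A]}), set L^{(1)} = 𝔏(X|_{[0,τ_A]}); otherwise, with 𝔍(X|_{[0,τ_A]}) = (n_0, …, n_ι) and n_j the unique index among them with X_{n_j} = b, set L^{(1)} = (X_{n_0}, …, X_{n_j}) ⊕ ℜ(𝔏(ℜ(X|_{[n_j, τ_A]}))). Then for every self-avoiding finite path w = (w_0, …, w_η) with w_0 = x, w_η ∈ A, w_n ∉ A for all n < η, and w_j = b for some 0 ≤ j < η, one has ℙ_x(L^{(1)} = w) = ( ∏_{n=0}^{η-1} P(w_n, w_{n+1}) ) · ( ∏_{n=0}^{j-1} G_{A^c ∖ {w_0, …, w_{n-1}}}(w_n, w_n) ) · ( ∏_{n=1}^{η-j} G_{A^c ∖ {w_0, …, w_{j-1}, w_{η-1}, …, w_{η-n+1}}}(w_{η-n}, w_{η-n}) ), where for n = 1 the subtracted set in the last product is {w_0,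 …, w_{j-1}}. -/

import Mathlib

open MeasureTheory

namespace LERW

variable {V : Type*} [DecidableEq V]

/-- The suffix of `l` strictly after the last occurrence of `a` in `l`
(`l` itself if `a` does not occur in `l`). -/
def dropToLastOcc (a : V) (l : List V) : List V :=
  (l.reverse.takeWhile (fun z => z ≠ a)).reverse

lemma dropToLastOcc_length_le (a : V) (l : List V) :
    (dropToLastOcc a l).length ≤ l.length := by
  unfold dropToLastOcc
  calc ((l.reverse.takeWhile (fun z => z ≠ a)).reverse).length
      = (l.reverse.takeWhile (fun z => z ≠ a)).length := by simp
    _ ≤ l.reverse.length := (List.takeWhile_sublist _).length_le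
    _ = l.length := by simp

/-- Partial loop erasure `𝔏_S` of a finite path, associated with a set `S` of vertices. -/
def PLE (S : Finset V) : List V → List V
  | [] => []
  | a :: rest =>
    if a ∈ S then
      if a = (a :: rest).getLast (List.cons_ne_nil a rest) then [a]
      else a :: PLE S (dropToLastOcc a rest)
    else
      if rest = [] then [a]
      else a :: PLE S rest
termination_by l => l.length
decreasing_by
  · simpa using Nat.lt_succ_of_le (dropToLastOcc_length_le a rest)
  · simp

variable [Fintype V]

/-- The (full) loop erasure `𝔏 = 𝔏_V`. -/
def LE : List V → List V := PLE Finset.univ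

/-- Iterated partial loop erasure `𝔏_{W m} ∘ ⋯ ∘ 𝔏_{W 2} ∘ 𝔏_{W 1}`. -/
def iterPLE (W : ℕ → Finset V) : ℕ → List V → List V
  | 0, l => l
  | n + 1, l => PLE (W (n + 1)) (iterPLE W n l)

/-- The remaining suffix `w|_{[n_j , η]}` of the loop-erasing walk of `𝔏` the first time
its current value equals `b` (`[]` if this never happens). -/
def LEsuffixAt (b : V) : List V → List V
  | [] => []
  | a :: rest =>
    if a = b then a :: rest
    else if a = (a :: rest).getLast (List.cons_ne_nil a rest) then []
    else LEsuffixAt b (dropToLastOcc a rest)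
termination_by l => l.length
decreasing_by
  simpa using Nat.lt_succ_of_le (dropToLastOcc_length_le a rest)

/-- Entry time `τ_A` into `A ⊆ V`, valued in `ℕ∞`. -/
noncomputable def entryTime (A : Finset V) (ω : ℕ → V) : ℕ∞ :=
  sInf {m : ℕ∞ | ∃ n : ℕ, m = (n : ℕ∞) ∧ ω n ∈ A}

/-- Entry time `τ_A` as a natural number (junk value `0` when `A` is never visited). -/
noncomputable def entryTimeNat (A : Finset V) (ω : ℕ → V) : ℕ :=
  sInf {n : ℕ | ω n ∈ A}

/-- The random finite path `X|_{[0, τ_A]} = (X_0, X_1, …, X_{τ_A})`. -/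
noncomputable def stoppedPath (A : Finset V) (ω : ℕ → V) : List V :=
  (List.range (entryTimeNat A ω + 1)).map ω

/-- Iterated hitting times `τ̊_W^{(n)}` of `W`, valued in `ℕ∞` (with the convention
`τ̊_W^{(0)} = 0`). -/
noncomputable def iterHit (W : Finset V) (ω : ℕ → V) : ℕ → ℕ∞
  | 0 => 0
  | n + 1 => sInf {m : ℕ∞ | ∃ k : ℕ, m = (k : ℕ∞) ∧ iterHit W ω n < (k : ℕ∞) ∧ ω k ∈ W}

/-- The time `τ̊_W^{(n)} ∧ τ_A`, as a natural number. -/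
noncomputable def traceTime (W A : Finset V) (ω : ℕ → V) (n : ℕ) : ℕ :=
  (iterHit W ω n ⊓ entryTime A ω).toNat

variable [MeasurableSpace V]

/-- The trace process `X̃_n = X_{τ̊_W^{(n)} ∧ τ_A}` (so `X̃_0 = X_0`). -/
noncomputable def traceProc (W A : Finset V) (ω : ℕ → V) (n : ℕ) : V :=
  ω (traceTime W A ω n)

/-- The Green function `G_B(x, y) = 𝔼_x(#{0 ≤ n < τ_{V∖B} : X_n = y})`. -/
noncomputable def green (μ : V → Measure (ℕ → V)) (B : Finset V) (x y : V) : ℝ :=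
  ∑' n : ℕ, (μ x {ω | ω n = y ∧ ∀ k ≤ n, ω k ∈ B}).toReal

/-- The random finite path `L⁽¹⁾` built from `X|_{[0, τ_A]}`: erase loops chronologically
until the loop-erasing walk first sits on `b`, then erase loops in reverse order. -/
noncomputable def Lone {V : Type*} [Fintype V] [DecidableEq V]
    (A : Finset V) (b : V) (ω : ℕ → V) : List V :=
  if b ∈ LE (stoppedPath A ω) then
    ((LE (stoppedPath A ω)).takeWhile (fun z => z ≠ b) ++ [b]) ++
      ((LE (LEsuffixAt b (stoppedPath A ω)).reverse).reverse).tail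
  else LE (stoppedPath A ω)


section aux

variable {U : Type*} [DecidableEq U]

def IsLoop (a : U) (c : List U) : Prop := c.head? = some a ∧ c.getLast? = some a

lemma drop_append {a : U} {c d : List U} (hc : c.getLast? = some a) (hd : a ∉ d) :
    dropToLastOcc a (c ++ d) = d := by
  obtain ⟨c', rfl⟩ : ∃ c', c = c' ++ [a] := List.getLast?_eq_some_iff.mp hc
  unfold dropToLastOcc
  rw [List.append_assoc, List.reverse_append, List.reverse_append, List.append_assoc,
    List.takeWhile_append_of_pos]
  · simp
  · intro z hz
    simp only [List.mem_reverse] at hz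
    simp only [ne_eq, decide_not, Bool.not_eq_eq_eq_not, Bool.not_true, decide_eq_false_iff_not]
    rintro rfl
    exact hd hz

lemma drop_not_mem {a : U} {d : List U} (hd : a ∉ d) :
    dropToLastOcc a d = d := by
  unfold dropToLastOcc
  have : d.reverse.takeWhile (fun z => z ≠ a) = d.reverse := by
    rw [List.takeWhile_eq_self_iff]
    intro z hz
    simp only [List.mem_reverse] at hz
    simp only [ne_eq, decide_not, Bool.not_eq_eq_eq_not, Bool.not_true, decide_eq_false_iff_not]
    rintro rfl
    exact hd hz
  rw [this, List.reverse_reverse]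

lemma drop_tail {a : U} {c d : List U} (hc : IsLoop a (a :: c)) (hd : a ∉ d) :
    dropToLastOcc a (c ++ d) = d := by
  rcases c.eq_nil_or_concat with rfl | ⟨c', z, rfl⟩
  · simpa using drop_not_mem hd
  · apply drop_append _ hd
    have := hc.2
    rw [List.concat_eq_append, ← List.cons_append, List.getLast?_append] at this
    simpa using this

lemma exists_decomp (a : U) (l : List U) (h : a ∈ l) :
    ∃ c d, l = c ++ a :: d ∧ a ∉ d := by
  obtain ⟨s, t, h1, h2⟩ := List.eq_append_cons_of_mem (List.mem_reverse.mpr h)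
  refine ⟨t.reverse, s.reverse, ?_, by simpa using h2⟩
  have := congrArg List.reverse h1
  simpa using this

lemma loop_cases (a : U) (r : List U) :
    IsLoop a (a :: r) ∨ ∃ c d, IsLoop a c ∧ a ∉ d ∧ d ≠ [] ∧ a :: r = c ++ d := by
  obtain ⟨c, d, h, hd⟩ := exists_decomp a (a :: r) (by simp)
  have hh : (c ++ [a]).head? = some a := by
    rcases c with _ | ⟨z, c⟩
    · simp
    · simp at h; simp [h.1]
  rcases eq_or_ne d [] with rfl | hne
  · left
    rw [h]
    exact ⟨hh, by simp⟩
  · right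
    exact ⟨c ++ [a], d, ⟨hh, by simp⟩, hd, hne, by simp [h]⟩

variable [Fintype U]

lemma LE_nil : LE ([] : List U) = [] := by simp [LE, PLE]

lemma LE_cons (a : U) (r : List U) : LE (a :: r) =
    if a = (a :: r).getLast (List.cons_ne_nil a r) then [a] else a :: LE (dropToLastOcc a r) := by
  unfold LE
  rw [PLE]
  simp

lemma LEs_cons (b a : U) (r : List U) : LEsuffixAt b (a :: r) =
    if a = b then a :: r else if a = (a :: r).getLast (List.cons_ne_nil a r) then []
    else LEsuffixAt b (dropToLastOcc a r) := by
  rw [LEsuffixAt]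

lemma loop_cons {a : U} {c : List U} (h : IsLoop a c) : ∃ r, c = a :: r :=
  List.head?_eq_some_iff.mp h.1

lemma LE_loop {a : U} {c : List U} (h : IsLoop a c) : LE c = [a] := by
  obtain ⟨r, rfl⟩ := loop_cons h
  rw [LE_cons, if_pos]
  have := h.2
  rw [List.getLast?_eq_some_getLast (List.cons_ne_nil a r)] at this
  exact (Option.some.inj this).symm

lemma last_ne {a : U} {l d : List U} (hd : a ∉ d) (hne : d ≠ []) (h : l ++ d ≠ []) :
    a ≠ (l ++ d).getLast h := by
  rw [List.getLast_append_of_ne_nil _ hne]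
  rintro e
  exact hd (e ▸ List.getLast_mem hne)

lemma LE_append {a : U} {c d : List U} (h : IsLoop a c) (hd : a ∉ d) (hne : d ≠ []) :
    LE (c ++ d) = a :: LE d := by
  obtain ⟨r, rfl⟩ := loop_cons h
  rw [List.cons_append, LE_cons, if_neg, drop_tail h hd]
  exact last_ne (l := a :: r) hd hne (by simp)

lemma LEs_append {b a : U} {c d : List U} (h : IsLoop a c) (hd : a ∉ d) (hne : d ≠ [])
    (hb : a ≠ b) : LEsuffixAt b (c ++ d) = LEsuffixAt b d := by
  obtain ⟨r, rfl⟩ := loop_cons h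
  rw [List.cons_append, LEs_cons, if_neg hb, if_neg, drop_tail h hd]
  exact last_ne (l := a :: r) hd hne (by simp)

lemma LE_head (l : List U) : (LE l).head? = l.head? := by
  rcases l with _ | ⟨a, r⟩
  · simp [LE_nil]
  · rw [LE_cons]; split_ifs <;> simp

lemma LE_last (l : List U) : (LE l).getLast? = l.getLast? := by
  induction hn : l.length using Nat.strong_induction_on generalizing l with
  | _ n ih =>
  rcases l with _ | ⟨a, r⟩
  · simp [LE_nil]
  · rcases loop_cases a r with h | ⟨c, d, h, hd, hne, e⟩
    · rw [LE_loop h, h.2]; simp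
    · rw [e, LE_append h hd hne]
      obtain ⟨r', rfl⟩ := loop_cons h
      have e2 := congrArg List.length e
      simp at e2 hn
      have := ih d.length (by omega) d rfl
      have hne' : LE d ≠ [] := by
        intro h0
        rw [h0] at this
        exact hne (List.getLast?_eq_none_iff.mp (by simpa using this.symm))
      rw [List.getLast?_append_of_ne_nil _ hne, ← this]
      have := List.getLast?_append_of_ne_nil [a] hne'
      simpa using this

def FL (b : U) (l : List U) : List U :=
  if b ∈ LE l then
    ((LE l).takeWhile (fun z => z ≠ b) ++ [b]) ++
      ((LE (LEsuffixAt b l).reverse).reverse).tail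
  else LE l

lemma FL_loop {b a : U} {c : List U} (h : IsLoop a c) (hb : a ≠ b) : FL b c = [a] := by
  unfold FL
  rw [LE_loop h, if_neg]
  simpa using hb.symm

lemma FL_append {b a : U} {c d : List U} (h : IsLoop a c) (hd : a ∉ d) (hne : d ≠ [])
    (hb : a ≠ b) : FL b (c ++ d) = a :: FL b d := by
  unfold FL
  rw [LE_append h hd hne, LEs_append h hd hne hb]
  by_cases hm : b ∈ LE d
  · simp [hm, hb]
  · simp [hm, hb.symm]

lemma FL_head {b : U} {l : List U} (h : l.head? = some b) :
    FL b l = b :: (LE l.reverse).reverse.tail := by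
  have h1 := LE_head l
  rw [h] at h1
  obtain ⟨r, hr⟩ := List.head?_eq_some_iff.mp h1
  obtain ⟨r', rfl⟩ := List.head?_eq_some_iff.mp h
  unfold FL
  rw [hr, LEs_cons]
  simp

lemma FL_head' {b : U} {l : List U} (h : l.head? = some b) :
    FL b l = (LE l.reverse).reverse := by
  rw [FL_head h]
  have h1 := LE_last l.reverse
  rw [List.getLast?_reverse, h] at h1
  have : (LE l.reverse).reverse.head? = some b := by simpa using h1
  obtain ⟨r, hr⟩ := List.head?_eq_some_iff.mp this
  rw [hr]; simp

lemma FL_head? (b : U) (l : List U) : (FL b l).head? = l.head? := by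
  rcases l with _ | ⟨a, r⟩
  · simp [FL, LE_nil]
  · by_cases hab : a = b
    · subst hab
      rw [FL_head (by simp)]; simp
    · rcases loop_cases a r with h | ⟨c, d, h, hd, hne, e⟩
      · rw [FL_loop h hab]; simp
      · rw [e, FL_append h hd hne hab, ← e]; simp


open scoped ENNReal

noncomputable def wt (p : U → U → ℝ≥0∞) : List U → ℝ≥0∞
  | [] => 1
  | [_] => 1
  | a :: b :: r => p a b * wt p (b :: r)

lemma wt_append (p : U → U → ℝ≥0∞) {c d : List U} {a e : U} (hc : c.getLast? = some a)
    (hd : d.head? = some e) : wt p (c ++ d) = wt p c * p a e * wt p d := by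
  obtain ⟨r, rfl⟩ := List.head?_eq_some_iff.mp hd
  induction c with
  | nil => simp at hc
  | cons z c ih =>
    rcases c with _ | ⟨y, c⟩
    · simp at hc
      subst hc
      simp [wt]
    · have := ih (by simpa using hc)
      simp only [List.cons_append, wt] at this ⊢
      rw [this]; ring

lemma wt_reverse (p : U → U → ℝ≥0∞) (l : List U) :
    wt p l.reverse = wt (fun a b => p b a) l := by
  induction l with
  | nil => simp [wt]
  | cons a l ih =>
    rcases l with _ | ⟨y, c⟩
    · simp [wt]
    · rw [List.reverse_cons, wt_append p (a := y) (e := a) (by simp) (by simp), ih]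
      simp [wt]; ring

noncomputable def WW (p : U → U → ℝ≥0∞) (S : Set (List U)) : ℝ≥0∞ := ∑' l : S, wt p l

lemma WW_prod (p : U → U → ℝ≥0∞) (S1 S2 S : Set (List U)) (k : ℝ≥0∞)
    (hb : Set.BijOn (fun q : List U × List U => q.1 ++ q.2) (S1 ×ˢ S2) S)
    (hw : ∀ c ∈ S1, ∀ d ∈ S2, wt p (c ++ d) = wt p c * k * wt p d) :
    WW p S = WW p S1 * k * WW p S2 := by
  unfold WW
  rw [← (hb.equiv).tsum_eq (fun l : S => wt p l)]
  rw [← (Equiv.Set.prod S1 S2).symm.tsum_eq, ENNReal.tsum_prod', ← ENNReal.tsum_mul_right,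
    ← ENNReal.tsum_mul_right]
  refine tsum_congr fun c => ?_
  rw [← ENNReal.tsum_mul_left]
  refine tsum_congr fun d => ?_
  exact hw c c.2 d d.2

lemma WW_image (p p' : U → U → ℝ≥0∞) (S S' : Set (List U)) (k : ℝ≥0∞) (f : List U → List U)
    (hb : Set.BijOn f S S')
    (hw : ∀ c ∈ S, wt p' (f c) = wt p c * k) :
    WW p' S' = WW p S * k := by
  unfold WW
  rw [← (hb.equiv).tsum_eq (fun l : S' => wt p' l), ← ENNReal.tsum_mul_right]
  exact tsum_congr fun c => hw c c.2

def Loops (B : Finset U) (a : U) : Set (List U) := {c | IsLoop a c ∧ ∀ v ∈ c, v ∈ B}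

lemma WW_loops_rev (p : U → U → ℝ≥0∞) (B : Finset U) (a : U) :
    WW (fun a b => p b a) (Loops B a) = WW p (Loops B a) := by
  have := WW_image p (fun a b => p b a) (Loops B a) (Loops B a) 1 List.reverse ?_ ?_
  · simpa using this
  · refine ⟨?_, List.reverse_injective.injOn, ?_⟩
    · rintro c ⟨⟨h1, h2⟩, h3⟩
      exact ⟨⟨by simpa using h2, by simpa using h1⟩, by simpa using h3⟩
    · rintro c ⟨⟨h1, h2⟩, h3⟩
      exact ⟨c.reverse, ⟨⟨by simpa using h2, by simpa using h1⟩, by simpa using h3⟩, by simp⟩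
  · intro c _
    rw [wt_reverse, mul_one]

noncomputable def gp (p : U → U → ℝ≥0∞) : Finset U → List U → ℝ≥0∞
  | _, [] => 1
  | B, a :: u => WW p (Loops B a) * gp p (B \ {a}) u

lemma gp_rev (p : U → U → ℝ≥0∞) (B : Finset U) (u : List U) :
    gp (fun a b => p b a) B u = gp p B u := by
  induction u generalizing B with
  | nil => rfl
  | cons a u ih => simp only [gp]; rw [ih, WW_loops_rev]

lemma gp_snoc (p : U → U → ℝ≥0∞) (B : Finset U) (u : List U) (a : U) :
    gp p B (u ++ [a]) = gp p B u * WW p (Loops (B \ u.toFinset) a) := by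
  induction u generalizing B with
  | nil => simp [gp]
  | cons z u ih =>
    simp only [gp, List.cons_append]
    rw [ih, mul_assoc]
    congr 4
    ext v; simp [and_assoc]

lemma gp_range (p : U → U → ℝ≥0∞) (B : Finset U) (f : ℕ → U) (m : ℕ) :
    gp p B ((List.range m).map f) =
      ∏ n ∈ Finset.range m, WW p (Loops (B \ (Finset.range n).image f) (f n)) := by
  induction m with
  | zero => simp [gp]
  | succ m ih =>
    rw [List.range_succ, List.map_append, List.map_singleton, gp_snoc, ih, Finset.prod_range_succ]
    congr 4


lemma wt_range (p : U → U → ℝ≥0∞) (f : ℕ → U) (m : ℕ) :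
    wt p ((List.range (m + 1)).map f) = ∏ n ∈ Finset.range m, p (f n) (f (n + 1)) := by
  induction m with
  | zero => simp [wt]
  | succ m ih =>
    rw [List.range_succ, List.map_append, List.map_singleton,
      wt_append p (a := f m) (e := f (m + 1)) (by simp [List.range_succ]) (by simp), ih,
      Finset.prod_range_succ]
    simp [wt]

/-- append is injective on loops times paths avoiding `a`. -/
lemma append_inj {a : U} {c d c' d' : List U} (h : IsLoop a c) (h' : IsLoop a c')
    (hd : a ∉ d) (hd' : a ∉ d') (e : c ++ d = c' ++ d') : c = c' ∧ d = d' := by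
  have h1 := drop_append h.2 hd
  rw [e, drop_append h'.2 hd'] at h1
  subst h1
  exact ⟨List.append_cancel_right e, rfl⟩

def ES (B : Finset U) (u : List U) : Set (List U) := {l | LE l = u ∧ ∀ v ∈ l, v ∈ B}

lemma WW_ES_step (p : U → U → ℝ≥0∞) (B : Finset U) (a e : U) (u : List U) :
    WW p (ES B (a :: e :: u)) =
      WW p (Loops B a) * p a e * WW p (ES (B \ {a}) (e :: u)) := by
  have ne : ∀ d : List U, LE d = e :: u → d ≠ [] := by
    rintro d h rfl
    simp [LE_nil] at h
  apply WW_prod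
  · refine ⟨?_, ?_, ?_⟩
    · rintro ⟨c, d⟩ ⟨⟨h1, h2⟩, h3, h4⟩
      simp only [Finset.mem_sdiff, Finset.mem_singleton] at h3 h4
      refine ⟨?_, ?_⟩
      · show LE (c ++ d) = _
        rw [LE_append h1 (fun ha => (h4 a ha).2 rfl) (ne d h3), h3]
      · intro v hv
        rcases List.mem_append.mp hv with hv | hv
        · exact h2 v hv
        · exact (h4 v hv).1
    · rintro ⟨c, d⟩ ⟨⟨h1, h2⟩, h3, h4⟩ ⟨c', d'⟩ ⟨⟨h1', h2'⟩, h3', h4'⟩ he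
      simp only [Finset.mem_sdiff, Finset.mem_singleton] at h4 h4'
      have := append_inj h1 h1' (fun ha => (h4 a ha).2 rfl) (fun ha => (h4' a ha).2 rfl) he
      exact Prod.ext this.1 this.2
    · rintro l ⟨h1, h2⟩
      have hh := LE_head l
      rw [h1] at hh
      obtain ⟨r, rfl⟩ := List.head?_eq_some_iff.mp hh.symm
      rcases loop_cases a r with h | ⟨c, d, h, hd, hne, e'⟩
      · rw [LE_loop h] at h1; simp at h1
      · rw [e'] at h1 h2 ⊢
        rw [LE_append h hd hne] at h1
        refine ⟨(c, d), ⟨⟨h, fun v hv => h2 v (by simp [hv])⟩, ?_, fun v hv => ?_⟩, rfl⟩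
        · simpa using h1
        · simp only [Finset.mem_sdiff, Finset.mem_singleton]
          exact ⟨h2 v (by simp [hv]), fun e => hd (e ▸ hv)⟩
  · rintro c ⟨h1, h2⟩ d ⟨h3, h4⟩
    refine wt_append p h1.2 ?_
    rw [← LE_head, h3]; rfl

lemma ES_single (B : Finset U) (a : U) : ES B [a] = Loops B a := by
  ext l
  constructor
  · rintro ⟨h1, h2⟩
    refine ⟨⟨?_, ?_⟩, h2⟩
    · rw [← LE_head, h1]; rfl
    · rw [← LE_last, h1]; rfl
  · rintro ⟨h1, h2⟩
    exact ⟨LE_loop h1, h2⟩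

lemma WW_ES (p : U → U → ℝ≥0∞) (B : Finset U) (a : U) (u : List U) :
    WW p (ES B (a :: u)) = gp p B (a :: u) * wt p (a :: u) := by
  induction u generalizing a B with
  | nil => rw [ES_single]; simp [gp, wt]
  | cons e u ih =>
    rw [WW_ES_step, ih]
    simp only [gp, wt]; ring


def TS (A B : Finset U) (b : U) (v u : List U) : Set (List U) :=
  {l | (∃ i z, l = i ++ [z] ∧ (∀ t ∈ i, t ∈ B) ∧ z ∈ A) ∧ FL b l = u ++ b :: v}

lemma WW_TS_step (p : U → U → ℝ≥0∞) (A B : Finset U) (a b e : U) (u v : List U)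
    (hab : a ≠ b) (haA : a ∉ A) (he : (u ++ b :: v).head? = some e) :
    WW p (TS A B b v (a :: u)) =
      WW p (Loops B a) * p a e * WW p (TS A (B \ {a}) b v u) := by
  have nm : ∀ d ∈ TS A (B \ {a}) b v u, a ∉ d ∧ d ≠ [] := by
    rintro d ⟨⟨i, z, rfl, h1, h2⟩, h3⟩
    refine ⟨?_, by simp⟩
    intro hm
    rcases List.mem_append.mp hm with hm | hm
    · have := h1 a hm
      simp at this
    · simp at hm
      exact haA (hm ▸ h2)
  apply WW_prod
  · refine ⟨?_, ?_, ?_⟩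
    · rintro ⟨c, d⟩ ⟨⟨h1, h2⟩, hd⟩
      obtain ⟨n1, n2⟩ := nm d hd
      obtain ⟨⟨i, z, hiz, h3, h4⟩, h5⟩ := hd
      refine ⟨⟨c ++ i, z, ?_, ?_, h4⟩, ?_⟩
      · simp at hiz
        simp [hiz]
      · intro t ht
        rcases List.mem_append.mp ht with ht | ht
        · exact h2 t ht
        · exact (Finset.mem_sdiff.mp (h3 t ht)).1
      · show FL b (c ++ d) = _
        simp only at n1 n2 h5
        rw [FL_append h1 n1 n2 hab, h5]; rfl
    · rintro ⟨c, d⟩ ⟨⟨h1, h2⟩, hd⟩ ⟨c', d'⟩ ⟨⟨h1', h2'⟩, hd'⟩ he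
      have := append_inj h1 h1' (nm _ hd).1 (nm _ hd').1 he
      exact Prod.ext this.1 this.2
    · rintro l ⟨⟨i, z, hiz, h3, h4⟩, h5⟩
      have hh := FL_head? b l
      rw [h5] at hh
      obtain ⟨r, rfl⟩ := List.head?_eq_some_iff.mp hh.symm
      rcases loop_cases a r with h | ⟨c, d, h, hd, hne, e'⟩
      · rw [FL_loop h hab] at h5; simp at h5
      · rw [e'] at h5 hiz ⊢
        rw [FL_append h hd hne hab] at h5
        obtain ⟨i', z', rfl⟩ : ∃ i' z', d = i' ++ [z'] := by
          rcases d.eq_nil_or_concat with rfl | ⟨i', z', rfl⟩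
          · exact absurd rfl hne
          · exact ⟨i', z', by simp⟩
        rw [← List.append_assoc] at hiz
        obtain ⟨rfl, hz⟩ := List.append_inj' hiz rfl
        obtain rfl : z' = z := by simpa using hz
        refine ⟨(c, i' ++ [z']), ⟨⟨h, fun t ht => h3 t (by simp [ht])⟩,
          ⟨i', z', rfl, fun t ht => ?_, h4⟩, ?_⟩, rfl⟩
        · simp only [Finset.mem_sdiff, Finset.mem_singleton]
          exact ⟨h3 t (by simp [ht]), fun e => hd (by simp [← e, ht])⟩
        · simpa using h5
  · rintro c ⟨h1, h2⟩ d ⟨h3, h4⟩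
    refine wt_append p h1.2 ?_
    rw [← FL_head? b, h4]; exact he

lemma WW_TS_base (p : U → U → ℝ≥0∞) (A B : Finset U) (b z0 : U) (v0 : List U)
    (hbA : b ∉ A) (hz0 : z0 ∈ A) (hB : ∀ t ∈ B, t ∉ A) :
    WW p (TS A B b (v0 ++ [z0]) []) = gp p B (b :: v0).reverse * wt p (b :: (v0 ++ [z0])) := by
  obtain ⟨y, r, hy⟩ : ∃ y r, (b :: v0).reverse = y :: r := by
    rcases h : (b :: v0).reverse with _ | ⟨y, r⟩
    · simp at h
    · exact ⟨y, r, rfl⟩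
  have key := WW_image (fun a b => p b a) p (ES B (b :: v0).reverse)
    (TS A B b (v0 ++ [z0]) []) (p y z0) (fun e => e.reverse ++ [z0]) ?_ ?_
  · rw [key, hy, WW_ES, gp_rev, ← hy, ← wt_reverse, List.reverse_reverse, ← List.cons_append,
      wt_append p (a := y) (e := z0) (c := b :: v0) (by simp [← List.head?_reverse, hy]) rfl]
    simp only [wt]; ring
  · refine ⟨?_, ?_, ?_⟩
    · rintro e ⟨h1, h2⟩
      have hl : e.getLast? = some b := by rw [← LE_last, h1]; simp
      have hz : z0 ∉ e := fun h => hB _ (h2 _ h) hz0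
      have hne : e ≠ [] := by rintro rfl; simp at hl
      refine ⟨⟨e.reverse, z0, rfl, by simpa using h2, hz0⟩, ?_⟩
      rw [FL_head']
      · simp only [List.reverse_append, List.reverse_reverse]
        rw [LE_append (a := z0) (c := [z0].reverse) ⟨by simp, by simp⟩ hz hne, h1]
        simp
      · simp [List.head?_append, hl]
    · intro e _ e' _ h
      simpa using h
    · rintro l ⟨⟨i, z, rfl, h3, h4⟩, h5⟩
      have hh := FL_head? b (i ++ [z])
      rw [h5] at hh
      rw [FL_head' hh.symm] at h5
      have hz : z ∉ i.reverse := fun h => hB _ (h3 _ (by simpa using h)) h4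
      have hne : i.reverse ≠ [] := by
        intro h0
        obtain rfl : i = [] := by simpa using h0
        simp at hh
        exact hbA (hh ▸ h4)
      simp only [List.reverse_append] at h5
      rw [LE_append (a := z) (c := [z].reverse) ⟨by simp, by simp⟩ hz hne] at h5
      have h6 := congrArg List.reverse h5
      simp at h6
      obtain ⟨rfl, h6⟩ := h6
      exact ⟨i.reverse, ⟨by simpa using h6, by simpa using h3⟩, by simp⟩
  · rintro e ⟨h1, h2⟩
    show wt p (e.reverse ++ [z0]) = _
    rw [wt_append p (a := y) (e := z0) (by rw [List.getLast?_reverse, ← LE_head, h1, hy]; rfl) rfl, wt_reverse]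
    simp [wt]

lemma WW_TS (p : U → U → ℝ≥0∞) (A B : Finset U) (b z0 : U) (u v0 : List U)
    (hbA : b ∉ A) (hz0 : z0 ∈ A) (hB : ∀ t ∈ B, t ∉ A) (hu : ∀ t ∈ u, t ≠ b ∧ t ∉ A) :
    WW p (TS A B b (v0 ++ [z0]) u) = gp p B u * gp p (B \ u.toFinset) (b :: v0).reverse *
      wt p (u ++ b :: (v0 ++ [z0])) := by
  induction u generalizing B with
  | nil => rw [WW_TS_base p A B b z0 v0 hbA hz0 hB]; simp [gp]
  | cons a u ih =>
    obtain ⟨e, he⟩ : ∃ e, (u ++ b :: (v0 ++ [z0])).head? = some e := by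
      rcases u with _ | ⟨e, u⟩ <;> simp
    rw [WW_TS_step p A B a b e u _ (hu a (by simp)).1 (hu a (by simp)).2 he,
      ih (B \ {a}) (fun t ht => hB t (Finset.mem_sdiff.mp ht).1) (fun t ht => hu t (by simp [ht]))]
    have e1 : (B \ {a}) \ u.toFinset = B \ (a :: u).toFinset := by
      ext t; simp [and_assoc]
    have e2 := wt_append p (c := [a]) (a := a) rfl he
    rw [e1, List.cons_append]
    simp only [List.singleton_append] at e2
    rw [e2]
    simp only [gp, wt]; ring


def cyl (l : List U) : Set (ℕ → U) := {ω | (List.range l.length).map ω = l}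

lemma cyl_range (n : ℕ) (y : ℕ → U) :
    cyl ((List.range (n + 1)).map y) = {ω : ℕ → U | ∀ i ≤ n, ω i = y i} := by
  ext ω
  simp only [cyl, List.length_map, List.length_range, Set.mem_setOf_eq, List.map_inj_left,
    List.mem_range, Nat.lt_succ_iff]

lemma exists_range (x : U) (r : List U) :
    ∃ y : ℕ → U, x :: r = (List.range (r.length + 1)).map y := by
  refine ⟨fun i => (x :: r).getD i x, ?_⟩
  apply List.ext_getElem
  · simp
  · intro i h1 h2
    simp only [List.getElem_map, List.getElem_range]
    rw [List.getD_eq_getElem _ _ h1]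

section prob

variable [MeasurableSpace U] [MeasurableSingletonClass U]

lemma cyl_meas (l : List U) : MeasurableSet (cyl l) := by
  rcases l with _ | ⟨x, r⟩
  · simp [cyl]
  · obtain ⟨y, hy⟩ := exists_range x r
    rw [hy, cyl_range]
    simp only [Set.setOf_forall]
    refine MeasurableSet.iInter fun i => MeasurableSet.iInter fun _ => ?_
    exact measurableSet_preimage (measurable_pi_apply (X := fun _ => U) i)
      (measurableSet_singleton (y i))

variable (P : U → U → ℝ) (μ : U → Measure (ℕ → U))
    (hP0 : ∀ a b : U, 0 ≤ P a b)
    (hprob : ∀ a : U, IsProbabilityMeasure (μ a))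
    (hlaw : ∀ (a : U) (n : ℕ) (y : ℕ → U),
      μ a {ω | ∀ i ≤ n, ω i = y i} =
        ENNReal.ofReal ((if a = y 0 then (1 : ℝ) else 0) *
          ∏ i ∈ Finset.Icc 1 n, P (y (i - 1)) (y i)))

include hP0 hlaw

lemma cyl_prob (x : U) (l : List U) (hl : l.head? = some x) :
    μ x (cyl l) = wt (fun a b => ENNReal.ofReal (P a b)) l := by
  obtain ⟨r, rfl⟩ := List.head?_eq_some_iff.mp hl
  obtain ⟨y, hy⟩ := exists_range x r
  rw [hy, cyl_range, wt_range, hlaw]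
  have hy0 : x = y 0 := by
    have := congrArg List.head? hy
    simpa [List.range_succ_eq_map] using this
  rw [if_pos hy0, one_mul, ENNReal.ofReal_prod_of_nonneg (fun _ _ => hP0 _ _)]
  have e : Finset.Icc 1 r.length = Finset.Ico (0 + 1) (r.length + 1) := by
    ext i; simp [Nat.lt_succ_iff]
  rw [Finset.range_eq_Ico, e, ← Finset.prod_Ico_add']
  simp

lemma union_prob (x : U) (S : Set (List U)) (hS : ∀ l ∈ S, l.head? = some x)
    (hd : S.PairwiseDisjoint cyl) :
    μ x (⋃ l ∈ S, cyl l) = WW (fun a b => ENNReal.ofReal (P a b)) S := by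
  rw [measure_biUnion S.to_countable hd (fun l _ => cyl_meas l)]
  exact tsum_congr fun l => cyl_prob P μ hP0 hlaw x l (hS l l.2)

include hprob

lemma green_n (B : Finset U) (a : U) (n : ℕ) :
    μ a {ω | ω n = a ∧ ∀ k ≤ n, ω k ∈ B} =
      WW (fun a b => ENNReal.ofReal (P a b)) (Loops B a ∩ {l | l.length = n + 1}) := by
  have h0 : ∀ᵐ ω ∂(μ a), ω 0 = a := by
    have h1 := hlaw a 0 (fun _ => a)
    simp only [nonpos_iff_eq_zero, forall_eq] at h1
    have := hprob a
    have hm : MeasurableSet {ω : ℕ → U | ω 0 = a} :=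
      measurableSet_preimage (measurable_pi_apply (X := fun _ => U) 0)
        (measurableSet_singleton a)
    exact (mem_ae_iff_prob_eq_one hm).mpr (by simpa using h1)
  rw [← union_prob P μ hP0 hlaw a]
  · apply measure_congr
    filter_upwards [h0] with ω hω
    apply propext
    show (ω n = a ∧ ∀ k ≤ n, ω k ∈ B) ↔ ω ∈ ⋃ l ∈ (Loops B a ∩ {l | l.length = n + 1}), cyl l
    simp only [Set.mem_iUnion]
    constructor
    · rintro ⟨h1, h2⟩
      refine ⟨(List.range (n + 1)).map ω, ⟨⟨⟨?_, ?_⟩, ?_⟩, by simp⟩, by simp [cyl]⟩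
      · simp [List.range_succ_eq_map, hω]
      · simp [List.range_succ, h1]
      · simpa [Nat.lt_succ_iff] using h2
    · rintro ⟨l, ⟨⟨⟨h1, h2⟩, h3⟩, h4⟩, h5⟩
      simp only [Set.mem_setOf_eq] at h4
      simp only [cyl, Set.mem_setOf_eq, h4] at h5
      subst h5
      simp [List.range_succ] at h2
      refine ⟨h2, ?_⟩
      simpa [Nat.lt_succ_iff] using h3
  · rintro l ⟨⟨h, _⟩, _⟩
    exact h.1
  · rintro l ⟨_, h⟩ l' ⟨_, h'⟩ hne
    refine Set.disjoint_left.mpr fun ω h1 h2 => hne ?_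
    simp only [Set.mem_setOf_eq] at h h'
    simp only [cyl, Set.mem_setOf_eq, h, h'] at h1 h2
    exact h1.symm.trans h2

lemma green_eq (B : Finset U) (a : U) :
    green μ B a a = (WW (fun a b => ENNReal.ofReal (P a b)) (Loops B a)).toReal := by
  unfold green
  rw [← ENNReal.tsum_toReal_eq (fun n => by have := hprob a; exact measure_ne_top _ _)]
  congr 1
  simp_rw [green_n P μ hP0 hprob hlaw B a]
  unfold WW
  simp_rw [tsum_subtype]
  rw [ENNReal.tsum_comm]
  refine tsum_congr fun l => ?_
  rw [tsum_eq_single (l.length - 1)]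
  · by_cases h : l ∈ Loops B a
    · obtain ⟨r, rfl⟩ := loop_cons h.1
      simp [Set.indicator, h]
    · simp [Set.indicator, h]
  · intro n hn
    apply Set.indicator_of_notMem
    rintro ⟨_, h⟩
    simp only [Set.mem_setOf_eq] at h
    omega

end prob

lemma stopped_of_cyl (A : Finset U) (i : List U) (z : U) (hi : ∀ t ∈ i, t ∉ A) (hz : z ∈ A)
    (ω : ℕ → U) (hω : ω ∈ cyl (i ++ [z])) :
    (∃ n, ω n ∈ A) ∧ stoppedPath A ω = i ++ [z] := by
  simp only [cyl, Set.mem_setOf_eq, List.length_append, List.length_singleton] at hω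
  have h := hω
  rw [List.range_succ, List.map_append] at h
  obtain ⟨h1, h2⟩ := List.append_inj' h rfl
  have h2 : ω i.length = z := by simpa using h2
  have hm : ω i.length ∈ A := h2 ▸ hz
  refine ⟨⟨_, hm⟩, ?_⟩
  have ht : entryTimeNat A ω = i.length := by
    apply le_antisymm
    · exact Nat.sInf_le hm
    · by_contra hlt
      push Not at hlt
      have : ω (entryTimeNat A ω) ∈ A := Nat.sInf_mem (s := {n | ω n ∈ A}) ⟨_, hm⟩
      refine hi _ ?_ this
      rw [← h1]
      exact List.mem_map.mpr ⟨_, List.mem_range.mpr hlt, rfl⟩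
  unfold stoppedPath
  rw [ht, hω]

lemma event_eq (A : Finset U) (b : U) (u v : List U) :
    {ω | (∃ n : ℕ, ω n ∈ A) ∧ Lone A b ω = u ++ b :: v} = ⋃ l ∈ TS A Aᶜ b v u, cyl l := by
  ext ω
  simp only [Set.mem_iUnion]
  constructor
  · rintro ⟨h1, h2⟩
    refine ⟨stoppedPath A ω, ⟨⟨(List.range (entryTimeNat A ω)).map ω, ω (entryTimeNat A ω),
      ?_, ?_, ?_⟩, h2⟩, ?_⟩
    · simp [stoppedPath, List.range_succ]
    · intro t ht
      obtain ⟨k, hk, rfl⟩ := List.mem_map.mp ht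
      rw [Finset.mem_compl]
      exact Nat.notMem_of_lt_sInf (s := {n | ω n ∈ A}) (List.mem_range.mp hk)
    · exact Nat.sInf_mem (s := {n | ω n ∈ A}) h1
    · simp [cyl, stoppedPath]
  · rintro ⟨l, ⟨⟨i, z, rfl, h3, h4⟩, h5⟩, h6⟩
    obtain ⟨h7, h8⟩ := stopped_of_cyl A i z (fun t ht => Finset.mem_compl.mp (h3 t ht)) h4 ω h6
    refine ⟨h7, ?_⟩
    show FL b (stoppedPath A ω) = _
    rw [h8, h5]

lemma TS_disj (A : Finset U) (b : U) (u v : List U) :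
    (TS A Aᶜ b v u).PairwiseDisjoint cyl := by
  rintro l ⟨⟨i, z, rfl, h3, h4⟩, h5⟩ l' ⟨⟨i', z', rfl, h3', h4'⟩, h5'⟩ hne
  refine Set.disjoint_left.mpr fun ω h1 h2 => hne ?_
  have e1 := (stopped_of_cyl A i z (fun t ht => Finset.mem_compl.mp (h3 t ht)) h4 ω h1).2
  have e2 := (stopped_of_cyl A i' z' (fun t ht => Finset.mem_compl.mp (h3' t ht)) h4' ω h2).2
  exact e1.symm.trans e2

end aux

theorem prob_Lone_eq_green_product
    {V : Type*} [Fintype V] [DecidableEq V] [Nonempty V]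
    [MeasurableSpace V] [MeasurableSingletonClass V]
    (P : V → V → ℝ) (μ : V → Measure (ℕ → V))
    (hP0 : ∀ a b : V, 0 ≤ P a b) (hP1 : ∀ a : V, ∑ b : V, P a b = 1)
    (hprob : ∀ a : V, IsProbabilityMeasure (μ a))
    (hlaw : ∀ (a : V) (n : ℕ) (y : ℕ → V),
      μ a {ω | ∀ i ≤ n, ω i = y i} =
        ENNReal.ofReal ((if a = y 0 then (1 : ℝ) else 0) *
          ∏ i ∈ Finset.Icc 1 n, P (y (i - 1)) (y i)))
    (A : Finset V) (hA : ∀ z : V, μ z {ω | ∃ n : ℕ, ω n ∈ A} = 1)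
    (b : V) (hbA : b ∉ A)
    (x : V) (η : ℕ) (w : ℕ → V)
    (hinj : ∀ i ≤ η, ∀ j ≤ η, w i = w j → i = j)
    (h0 : w 0 = x) (hη : w η ∈ A) (hmid : ∀ n < η, w n ∉ A)
    (j : ℕ) (hj : j < η) (hjb : w j = b) :
    (μ x {ω | (∃ n : ℕ, ω n ∈ A) ∧ Lone A b ω = (List.range (η + 1)).map w}).toReal =
      (∏ n ∈ Finset.range η, P (w n) (w (n + 1))) *
        (∏ n ∈ Finset.range j,
          green μ (Aᶜ \ (Finset.range n).image w) (w n) (w n)) *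
        ∏ n ∈ Finset.Icc 1 (η - j),
          green μ
            (Aᶜ \ ((Finset.range j).image w ∪ (Finset.Icc (η - n + 1) (η - 1)).image w))
            (w (η - n)) (w (η - n)) := by
  have hbB : ∀ n < j, w n ≠ b := by
    intro n hn h
    have := hinj n (by omega) j (by omega) (h.trans hjb.symm)
    omega
  set u : List V := (List.range j).map w with hu
  set v0 : List V := (List.range (η - 1 - j)).map (fun i => w (j + 1 + i)) with hv0
  have hpath : (List.range (η + 1)).map w = u ++ b :: (v0 ++ [w η]) := by
    have e : η + 1 = j + (1 + ((η - 1 - j) + 1)) := by omega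
    have e2 : j + (1 + (η - 1 - j)) = η := by omega
    rw [e, List.range_add, List.range_add, List.range_add]
    simp [hu, hv0, hjb, e2, Function.comp_def, Nat.add_assoc]
  have hrev : (b :: v0).reverse = (List.range (η - j)).map (fun n => w (η - 1 - n)) := by
    apply List.ext_getElem
    · simp [hv0]; omega
    · intro i h1 h2
      simp only [List.length_map, List.length_range] at h2
      rw [List.getElem_reverse]
      simp only [List.getElem_map, List.getElem_range]
      have hc : b :: v0 = (List.range (η - 1 - j + 1)).map (fun i => w (j + i)) := by
        rw [List.range_succ_eq_map]
        simp [hv0, hjb, Function.comp_def, Nat.add_assoc, Nat.add_comm, Nat.add_left_comm]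
      simp only [hc, List.getElem_map, List.getElem_range, List.length_map, List.length_range]
      congr 1; omega
  have hx : ∀ l ∈ TS A Aᶜ b (v0 ++ [w η]) u, l.head? = some x := by
    rintro l ⟨_, h⟩
    rw [← FL_head? b, h, ← hpath, List.range_succ_eq_map]
    simp [h0]
  rw [hpath, event_eq, union_prob P μ hP0 hlaw x _ hx (TS_disj A b u _),
    WW_TS _ A Aᶜ b (w η) u v0 hbA hη (fun t ht => Finset.mem_compl.mp ht), ← hpath, wt_range,
    hrev, hu, gp_range, gp_range]
  · rw [ENNReal.toReal_mul, ENNReal.toReal_mul, ENNReal.toReal_prod, ENNReal.toReal_prod,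
      ENNReal.toReal_prod]
    simp_rw [ENNReal.toReal_ofReal (hP0 _ _), ← green_eq P μ hP0 hprob hlaw]
    rw [mul_comm, ← mul_assoc]
    congr 1
    have e : Finset.Icc 1 (η - j) = Finset.Ico (0 + 1) (η - j + 1) := by
      ext i; simp [Nat.lt_succ_iff]
    rw [e, ← Finset.prod_Ico_add', ← Finset.range_eq_Ico]
    refine Finset.prod_congr rfl fun n hn => ?_
    have hn := Finset.mem_range.mp hn
    have e1 : η - (n + 1) = η - 1 - n := by omega
    rw [e1]
    congr 1
    rw [sdiff_sdiff_left]
    congr 1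
    have e3 : ((List.range j).map w).toFinset = (Finset.range j).image w := by
      ext t; simp
    rw [e3]
    rw [Finset.sup_eq_union]
    congr 1
    ext t
    simp only [Finset.mem_image, Finset.mem_range, Finset.mem_Icc]
    constructor
    · rintro ⟨k, hk, rfl⟩
      exact ⟨η - 1 - k, by omega, rfl⟩
    · rintro ⟨k, hk, rfl⟩
      exact ⟨η - 1 - k, by omega, by congr 1; omega⟩
  · intro t ht
    obtain ⟨k, hk, rfl⟩ := List.mem_map.mp ht
    have hk := List.mem_range.mp hk
    exact ⟨hbB k hk, hmid k (by omega)⟩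

end LERW
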